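/- Let F be an anisotropic area integrand on ℝ^(n+1) satisfying the symmetry condition. Then for all nonzero p and q in the span of {φ¹,…,φⁿ}: lim_{s→∞} F(sp − φ⁰)² · D²F|_{sp−φ⁰}(sp, q) = −Dₕ(p), where Dₕ(p) denotes the directional derivative at the point p, in the direction φ⁰, of the function v ↦ F(v)²·D²F|_v(φ⁰, q); in particular this limit exists and is finite. -/

import Mathlib

open Real Filter Set

/-- First derivative of `F` at `ν` applied to `v`. -/
noncomputable def D1 {E : Type*} [NormedAddCommGroup E] [NormedSpace ℝ E]
    (F : E → ℝ) (ν v : E) : ℝ :=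
  fderiv ℝ F ν v

/-- Second derivative of `F` at `ν` as a bilinear form. -/
noncomputable def D2 {E : Type*} [NormedAddCommGroup E] [NormedSpace ℝ E]
    (F : E → ℝ) (ν v w : E) : ℝ :=
  iteratedFDeriv ℝ 2 F ν ![v, w]

/-- Third derivative of `F` at `ν` as a trilinear form. -/
noncomputable def D3 {E : Type*} [NormedAddCommGroup E] [NormedSpace ℝ E]
    (F : E → ℝ) (ν v w z : E) : ℝ :=
  iteratedFDeriv ℝ 3 F ν ![v, w, z]

/-- `F : ℝ^(n+1) → ℝ` is an anisotropic area integrand: positive away from `0`,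
convex, `C³` away from `0`, positively homogeneous of degree one, and with
uniformly convex sublevel sets (encoded via positivity of the second derivative
in non-radial directions). -/
def IsAreaIntegrand {n : ℕ} (F : (Fin (n + 1) → ℝ) → ℝ) : Prop :=
  (∀ v : Fin (n + 1) → ℝ, v ≠ 0 → 0 < F v) ∧
  ConvexOn ℝ Set.univ F ∧
  ContDiffOn ℝ 3 F {(0 : Fin (n + 1) → ℝ)}ᶜ ∧
  (∀ (c : ℝ) (v : Fin (n + 1) → ℝ), 0 < c → F (c • v) = c * F v) ∧
  (∀ ν w : Fin (n + 1) → ℝ, ν ≠ 0 → (∀ c : ℝ, w ≠ c • ν) → 0 < D2 F ν w w)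

/-- The symmetry condition: `F(p + φ⁰) = F(p − φ⁰)` for `p` in the span of
`φ¹, …, φⁿ` (i.e. with vanishing `0`-th coordinate). -/
def SymmCond {n : ℕ} (F : (Fin (n + 1) → ℝ) → ℝ) : Prop :=
  ∀ p : Fin (n + 1) → ℝ, p 0 = 0 →
    F (p + Pi.single 0 1) = F (p - Pi.single 0 1)

/-- Smallness-of-third-derivatives condition with constant `C₁`, for directions
tangent to the level set of `F` at `ν`. -/
def SmallThird {n : ℕ} (F : (Fin (n + 1) → ℝ) → ℝ) (C₁ : ℝ) : Prop :=
  ∀ ν p q r : Fin (n + 1) → ℝ, ν ≠ 0 →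
    D1 F ν p = 0 → D1 F ν q = 0 → D1 F ν r = 0 →
    F ν ^ 2 * D3 F ν p q r ≤
      C₁ * Real.sqrt (F ν ^ 3 * D2 F ν p p * D2 F ν q q * D2 F ν r r)

section SecondDerivative

variable {E : Type*} [NormedAddCommGroup E] [NormedSpace ℝ E] {F : E → ℝ}

theorem D2_eq_fderiv_fderiv (F : E → ℝ) (ν v w : E) :
    D2 F ν v w = fderiv ℝ (fderiv ℝ F) ν v w := by
  simp [D2, iteratedFDeriv_two_apply]

theorem D2_comp_continuousLinearEquiv (F : E → ℝ) (A : E ≃L[ℝ] E) (ν v w : E) :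
    D2 (F ∘ A) ν v w = D2 F (A ν) (A v) (A w) := by
  unfold D2
  have h := A.iteratedFDerivWithin_comp_right F uniqueDiffOn_univ (mem_univ (A ν)) 2
  simp only [preimage_univ, iteratedFDerivWithin_univ] at h
  rw [h, ContinuousMultilinearMap.compContinuousLinearMap_apply]
  congr 1
  ext i
  fin_cases i <;> rfl

/-- The derivative of a positively `1`-homogeneous function is positively `0`-homogeneous. -/
theorem fderiv_smul_of_homogeneous (hom : ∀ (c : ℝ) (v : E), 0 < c → F (c • v) = c * F v)
    {c : ℝ} (hc : 0 < c) (v : E) : fderiv ℝ F (c • v) = fderiv ℝ F v := by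
  have h : (fun x => F (c • x)) = c • F := by
    ext x
    simp [hom c x hc]
  have h₁ := fderiv_comp_smul (𝕜 := ℝ) (f := F) (x := v) c
  rw [h, fderiv_const_smul_field] at h₁
  exact (smul_right_injective _ hc.ne' h₁).symm

/-- The second derivative of a positively `1`-homogeneous function is positively
`(-1)`-homogeneous. -/
theorem D2_smul_of_homogeneous (hom : ∀ (c : ℝ) (v : E), 0 < c → F (c • v) = c * F v)
    {c : ℝ} (hc : 0 < c) (ν v w : E) : c * D2 F (c • ν) v w = D2 F ν v w := by
  have h : (fun x => fderiv ℝ F (c • x)) = fderiv ℝ F := by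
    ext1 x
    exact fderiv_smul_of_homogeneous hom hc x
  have h₁ := fderiv_comp_smul (𝕜 := ℝ) (f := fderiv ℝ F) (x := ν) c
  rw [h] at h₁
  simp [D2_eq_fderiv_fderiv, h₁]

/-- The radial direction is in the kernel of the second derivative of a positively
`1`-homogeneous function. -/
theorem D2_self_of_homogeneous (hom : ∀ (c : ℝ) (v : E), 0 < c → F (c • v) = c * F v)
    {ν : E} (hd : DifferentiableAt ℝ (fderiv ℝ F) ν) (w : E) : D2 F ν ν w = 0 := by
  have hline : HasDerivAt (fun t : ℝ => t • ν) ν 1 := by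
    simpa using (hasDerivAt_id (1 : ℝ)).smul_const ν
  have h₁ : HasDerivAt (fun t : ℝ => fderiv ℝ F (t • ν)) (fderiv ℝ (fderiv ℝ F) ν ν) 1 := by
    refine HasFDerivAt.comp_hasDerivAt (x := (1 : ℝ)) ?_ hline
    simpa using hd.hasFDerivAt
  have h₂ : HasDerivAt (fun t : ℝ => fderiv ℝ F (t • ν)) 0 1 := by
    refine (hasDerivAt_const (1 : ℝ) (fderiv ℝ F ν)).congr_of_eventuallyEq ?_
    filter_upwards [lt_mem_nhds (zero_lt_one (α := ℝ))] with t ht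
    exact fderiv_smul_of_homogeneous hom ht ν
  rw [D2_eq_fderiv_fderiv, h₁.unique h₂, zero_apply]

theorem differentiableAt_fderiv_of_contDiffAt_three {ν : E} (hF : ContDiffAt ℝ 3 F ν) :
    DifferentiableAt ℝ (fderiv ℝ F) ν :=
  (hF.fderiv_right (m := 2) (by norm_num)).differentiableAt (by norm_num)

theorem differentiableAt_sq_mul_D2 {ν : E} (hF : ContDiffAt ℝ 3 F ν) (v w : E) :
    DifferentiableAt ℝ (fun x => F x ^ 2 * D2 F x v w) ν := by
  have h : DifferentiableAt ℝ (fderiv ℝ (fderiv ℝ F)) ν :=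
    ((hF.fderiv_right (m := 2) (by norm_num)).fderiv_right (m := 1)
      (by norm_num)).differentiableAt (by norm_num)
  have h₀ : DifferentiableAt ℝ F ν := hF.differentiableAt (by norm_num)
  simp only [D2_eq_fderiv_fderiv]
  fun_prop

end SecondDerivative

/-- A positively `1`-homogeneous function `G` vanishing and differentiable at `p` satisfies
`G (s • p - e) → -dG_p(e)` as `s → ∞`. -/
theorem tendsto_smul_sub_of_homogeneous {E : Type*} [NormedAddCommGroup E] [NormedSpace ℝ E]
    {G : E → ℝ} (hom : ∀ (c : ℝ) (v : E), 0 < c → G (c • v) = c * G v) {p : E} (hp : G p = 0)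
    (hd : DifferentiableAt ℝ G p) (e : E) :
    Tendsto (fun s : ℝ => G (s • p - e)) atTop (nhds (-(fderiv ℝ G p e))) := by
  have h := hd.hasFDerivAt.lim_real (-e)
  rw [map_neg] at h
  refine h.congr' ?_
  filter_upwards [eventually_gt_atTop 0] with s hs
  rw [hp, sub_zero, smul_eq_mul, ← hom s _ hs, smul_add, smul_inv_smul₀ hs.ne', sub_eq_add_neg]

/-- The reflection of `ℝ^(n+1)` in the hyperplane where the `0`-th coordinate vanishes. -/
noncomputable def reflectZero (n : ℕ) : (Fin (n + 1) → ℝ) ≃L[ℝ] (Fin (n + 1) → ℝ) :=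
  (LinearEquiv.ofInvolutive
    (LinearMap.id - (2 : ℝ) • (LinearMap.proj 0).smulRight (Pi.single 0 1))
    (by
      intro x
      ext i
      refine Fin.cases ?_ (fun j => ?_) i
      · simp
        ring
      · simp)).toContinuousLinearEquiv

theorem reflectZero_apply {n : ℕ} (x : Fin (n + 1) → ℝ) :
    reflectZero n x = x - (2 * x 0) • Pi.single 0 1 := by
  change x - (2 : ℝ) • x 0 • (Pi.single 0 1 : Fin (n + 1) → ℝ) = _
  rw [smul_smul]

theorem SymmCond.comp_reflectZero {n : ℕ} {F : (Fin (n + 1) → ℝ) → ℝ} (hsym : SymmCond F)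
    (hom : ∀ (c : ℝ) (v : Fin (n + 1) → ℝ), 0 < c → F (c • v) = c * F v) :
    F ∘ reflectZero n = F := by
  have key : ∀ (t : ℝ) (p : Fin (n + 1) → ℝ), 0 < t → p 0 = 0 →
      F (p + t • Pi.single 0 1) = F (p - t • Pi.single 0 1) := by
    intro t p ht hp
    have h := congrArg (t * ·) (hsym (t⁻¹ • p) (by simp [hp]))
    simpa only [← hom t _ ht, smul_add, smul_sub, smul_inv_smul₀ ht.ne'] using h
  ext x
  have hp : (x - x 0 • Pi.single 0 1 : Fin (n + 1) → ℝ) 0 = 0 := by simp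
  rw [Function.comp_apply, reflectZero_apply]
  rcases lt_trichotomy (x 0) 0 with h | h | h
  · convert key (-x 0) _ (neg_pos.mpr h) hp using 2 <;> module
  · simp [h]
  · convert (key (x 0) _ h hp).symm using 2 <;> module

theorem SymmCond.D2_single_eq_zero {n : ℕ} {F : (Fin (n + 1) → ℝ) → ℝ} (hsym : SymmCond F)
    (hom : ∀ (c : ℝ) (v : Fin (n + 1) → ℝ), 0 < c → F (c • v) = c * F v)
    {p q : Fin (n + 1) → ℝ} (hp : p 0 = 0) (hq : q 0 = 0) :
    D2 F p (Pi.single 0 1) q = 0 := by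
  have h := D2_comp_continuousLinearEquiv F (reflectZero n) p (Pi.single 0 1) q
  have he : reflectZero n (Pi.single 0 1) = -Pi.single 0 1 := by
    rw [reflectZero_apply, Pi.single_eq_same]
    module
  have hp' : reflectZero n p = p := by simp [reflectZero_apply, hp]
  have hq' : reflectZero n q = q := by simp [reflectZero_apply, hq]
  rw [hsym.comp_reflectZero hom, he, hp', hq'] at h
  simp only [D2_eq_fderiv_fderiv, map_neg, neg_apply] at h ⊢
  linarith

/-- Under the symmetry condition, for nonzero
`p, q ∈ span{φ¹,…,φⁿ}`,
`F(sp−φ⁰)²·D²F|_{sp−φ⁰}(sp,q)` converges as `s → ∞` to minus the directional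
derivative at `p`, in direction `φ⁰`, of `v ↦ F(v)²·D²F|_v(φ⁰,q)`. -/
theorem limit_cross_terms_at_infinity
    {n : ℕ} (F : (Fin (n + 1) → ℝ) → ℝ) (hF : IsAreaIntegrand F)
    (hsym : SymmCond F) :
    ∀ p q : Fin (n + 1) → ℝ, p ≠ 0 → q ≠ 0 → p 0 = 0 → q 0 = 0 →
      Filter.Tendsto
        (fun s : ℝ =>
          F (s • p - Pi.single 0 1) ^ 2 *
            D2 F (s • p - Pi.single 0 1) (s • p) q)
        Filter.atTop
        (nhds (-(fderiv ℝ (fun v : Fin (n + 1) → ℝ =>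
            F v ^ 2 * D2 F v (Pi.single 0 1) q) p (Pi.single 0 1)))) := by
  intro p q hp₀ _ hp hq
  obtain ⟨-, -, hsmooth, hom, -⟩ := hF
  have hC : ∀ v : Fin (n + 1) → ℝ, v ≠ 0 → ContDiffAt ℝ 3 F v := fun v hv =>
    hsmooth.contDiffAt (isOpen_compl_singleton.mem_nhds hv)
  refine (tendsto_smul_sub_of_homogeneous
    (G := fun v => F v ^ 2 * D2 F v (Pi.single 0 1) q) ?_ ?_
    (differentiableAt_sq_mul_D2 (hC p hp₀) _ _) (Pi.single 0 1)).congr ?_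
  · intro c v hc
    simp only [hom c v hc, ← D2_smul_of_homogeneous hom hc v]
    ring
  · simp [hsym.D2_single_eq_zero hom hp hq]
  · intro s
    have hv : s • p - Pi.single 0 1 ≠ (0 : Fin (n + 1) → ℝ) := fun h => by
      simpa [hp] using congrFun h 0
    have h := D2_self_of_homogeneous hom (differentiableAt_fderiv_of_contDiffAt_three (hC _ hv)) q
    simp only [D2_eq_fderiv_fderiv] at h ⊢
    rw [map_sub (fderiv ℝ (fderiv ℝ F) _) (s • p), sub_apply, sub_eq_zero] at h
    rw [h]
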